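/- Let c > 0 be a real number and let T : ℕ → ℕ → ℝ be a function satisfying: T(N, 0) ≤ c·N for all N ≥ 1; T(1, d) ≤ c for all d; and T(N, d) ≤ 2·T(⌈N/2⌉, d) + T(N, d−1) + c·N for all N ≥ 2 and d ≥ 1. Then for all N ≥ 1 and d ≥ 0, T(N, d) ≤ C(d + ⌈log₂ N⌉ + 2, d + 1) · c · N, where C(·,·) denotes the binomial coefficient. -/

import Mathlib

/-- The correction term in the sharpened bound for sizes `N` with `2 ^ k < N ≤ 2 ^ (k + 1)`:
an array obeying Pascal's rule, negative at only finitely many places. -/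
noncomputable def pascalCorrection : ℕ → ℕ → ℝ
  | 0, d => ((d : ℝ) ^ 2 - 3 * d - 1) / 2
  | k + 1, 0 => k + 5 / 4
  | k + 1, d + 1 => pascalCorrection k (d + 1) + pascalCorrection (k + 1) d

lemma pascalCorrection_succ_nonneg_of_le {k a : ℕ}
    (hk : ∀ d, a ≤ d → 0 ≤ pascalCorrection k d) (ha : 0 ≤ pascalCorrection (k + 1) a) :
    ∀ d, a ≤ d → 0 ≤ pascalCorrection (k + 1) d := by
  intro d hd
  induction d, hd using Nat.le_induction with
  | base => exact ha
  | succ d hd ih =>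
    rw [pascalCorrection]
    exact add_nonneg (hk _ (by omega)) ih

lemma pascalCorrection_two_nonneg {d : ℕ} (hd : 5 ≤ d) : 0 ≤ pascalCorrection 2 d := by
  refine pascalCorrection_succ_nonneg_of_le
    (pascalCorrection_succ_nonneg_of_le (fun n hn => ?_) ?_) ?_ d hd
  · have : (5 : ℝ) ≤ n := by exact_mod_cast hn
    rw [pascalCorrection]
    nlinarith
  · norm_num [pascalCorrection]
  · norm_num [pascalCorrection]

lemma pascalCorrection_nonneg_of_three_le {k : ℕ} (hk : 3 ≤ k) (d : ℕ) :
    0 ≤ pascalCorrection k d := by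
  induction k, hk using Nat.le_induction generalizing d with
  | base =>
    rcases le_or_gt 5 d with hd | hd
    · refine pascalCorrection_succ_nonneg_of_le
        (fun n hn => pascalCorrection_two_nonneg hn) ?_ d hd
      norm_num [pascalCorrection]
    · interval_cases d <;> norm_num [pascalCorrection]
  | succ k hk ih =>
    refine pascalCorrection_succ_nonneg_of_le (a := 0) (fun n _ => ih n) ?_ d (Nat.zero_le d)
    rw [pascalCorrection]
    positivity

lemma pascalCorrection_nonneg_of_five_le (k : ℕ) {d : ℕ} (hd : 5 ≤ d) :
    0 ≤ pascalCorrection k d := by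
  induction k generalizing d with
  | zero =>
    have : (5 : ℝ) ≤ d := by exact_mod_cast hd
    rw [pascalCorrection]
    nlinarith
  | succ k ih =>
    refine pascalCorrection_succ_nonneg_of_le (a := 5) (fun n hn => ih hn) ?_ d hd
    rcases le_or_gt 3 (k + 1) with hk | hk
    · exact pascalCorrection_nonneg_of_three_le hk 5
    · replace hk : k < 2 := by omega
      interval_cases k <;> norm_num [pascalCorrection]

lemma neg_two_pow_mul_pascalCorrection_le (k d : ℕ) :
    -(2 ^ k * pascalCorrection k d) ≤ (Nat.choose (d + (k + 1) + 2) (d + 1) : ℝ) := by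
  by_cases h : 5 ≤ d ∨ 3 ≤ k
  · have hz : 0 ≤ pascalCorrection k d := by
      rcases h with h | h
      · exact pascalCorrection_nonneg_of_five_le k h
      · exact pascalCorrection_nonneg_of_three_le h d
    exact (neg_nonpos.mpr (by positivity)).trans (Nat.cast_nonneg _)
  · obtain ⟨hd, hk⟩ : d < 5 ∧ k < 3 := by omega
    interval_cases k <;> interval_cases d <;> norm_num [pascalCorrection, Nat.choose]

lemma recurrence_le_pascalCorrection {c : ℝ} (hc : 0 < c) {T : ℕ → ℕ → ℝ}
    (hbase0 : ∀ N : ℕ, 1 ≤ N → T N 0 ≤ c * N)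
    (hbase1 : ∀ d : ℕ, T 1 d ≤ c)
    (hrec : ∀ N d : ℕ, 2 ≤ N → 1 ≤ d →
      T N d ≤ 2 * T ((N + 1) / 2) d + T N (d - 1) + c * N)
    (k N d : ℕ) (hlt : 2 ^ k < N) (hle : N ≤ 2 ^ (k + 1)) :
    T N d ≤ c * (((Nat.choose (d + (k + 1) + 2) (d + 1) : ℝ) - 1) * (N - 1) - 1 / 2
      - 2 ^ k * pascalCorrection k d) := by
  induction k generalizing N d with
  | zero =>
    obtain rfl : N = 2 := by simp at hlt hle; omega
    have hlin : T 2 d ≤ c * (4 * d + 2) := by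
      induction d with
      | zero => have := hbase0 2 (by norm_num); push_cast at this ⊢; linarith
      | succ d ih =>
        have h := hrec 2 (d + 1) le_rfl (by omega)
        have h1 := hbase1 (d + 1)
        norm_num at h
        push_cast
        linarith
    have hchoose : (Nat.choose (d + (0 + 1) + 2) (d + 1) : ℝ) = (d + 3) * (d + 2) / 2 := by
      rw [Nat.choose_symm_of_eq_add (show d + (0 + 1) + 2 = (d + 1) + 2 by ring),
        Nat.cast_choose_two]
      push_cast
      ring
    refine hlin.trans_eq ?_
    rw [hchoose, pascalCorrection]
    push_cast
    ring
  | succ k ih =>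
    have hpow : (2 : ℝ) ^ (k + 1) + 1 ≤ N := by exact_mod_cast hlt
    have hone : (1 : ℝ) ≤ 2 ^ k := one_le_pow₀ (by norm_num)
    have hN : 2 ≤ N := by have := Nat.one_le_two_pow (n := k + 1); omega
    induction d with
    | zero =>
      refine (hbase0 N (by omega)).trans (mul_le_mul_of_nonneg_left ?_ hc.le)
      rw [pascalCorrection]
      have hk : (0 : ℝ) ≤ k := Nat.cast_nonneg k
      rw [pow_succ] at hpow ⊢
      simp only [zero_add, Nat.choose_one_right]
      push_cast
      nlinarith [mul_le_mul_of_nonneg_left hpow hk]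
    | succ d ihd =>
      have hhalf := ih ((N + 1) / 2) (d + 1) (by rw [pow_succ] at hlt; omega)
        (by rw [pow_succ] at hle; omega)
      have hr := hrec N (d + 1) hN (by omega)
      rw [Nat.add_sub_cancel] at hr
      have hceil : 2 * ((((N + 1) / 2 : ℕ) : ℝ) - 1) ≤ N - 1 := by
        have : (2 * ((N + 1) / 2) : ℕ) ≤ N + 1 := by omega
        have : (2 * (((N + 1) / 2 : ℕ) : ℝ)) ≤ N + 1 := by exact_mod_cast this
        linarith
      have hpascal : (Nat.choose (d + 1 + (k + 1 + 1) + 2) (d + 1 + 1) : ℝ)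
          = Nat.choose (d + (k + 1 + 1) + 2) (d + 1)
            + Nat.choose (d + 1 + (k + 1) + 2) (d + 1 + 1) := by
        rw [show d + 1 + (k + 1 + 1) + 2 = (d + (k + 1 + 1) + 2) + 1 by ring,
          Nat.choose_succ_succ, show d + 1 + (k + 1) + 2 = d + (k + 1 + 1) + 2 by ring]
        push_cast
        rfl
      have hpos : (1 : ℝ) ≤ Nat.choose (d + 1 + (k + 1) + 2) (d + 1 + 1) := by
        exact_mod_cast Nat.choose_pos (by omega)
      rw [hpascal, pascalCorrection]
      generalize (Nat.choose (d + 1 + (k + 1) + 2) (d + 1 + 1) : ℝ) = b at *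
      have hmul := mul_le_mul_of_nonneg_left
        (mul_le_mul_of_nonneg_left hceil (sub_nonneg.mpr hpos)) hc.le
      rw [pow_succ] at ihd ⊢
      linarith

/-- The recurrence bound for the Vector Domination Problem: if `T(N, 0) ≤ c·N` for `N ≥ 1`,
`T(1, d) ≤ c` for all `d`, and `T(N, d) ≤ 2·T(⌈N/2⌉, d) + T(N, d-1) + c·N` for `N ≥ 2` and
`d ≥ 1`, then `T(N, d) ≤ C(d + ⌈log₂ N⌉ + 2, d + 1) · c · N` for all `N ≥ 1` and all `d`.
Here `⌈log₂ N⌉` is `Nat.clog 2 N`, the least `m` with `N ≤ 2 ^ m`, and `⌈N/2⌉ = (N + 1) / 2`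
in natural-number arithmetic. -/
theorem vector_domination_recurrence (c : ℝ) (hc : 0 < c) (T : ℕ → ℕ → ℝ)
    (hbase0 : ∀ N : ℕ, 1 ≤ N → T N 0 ≤ c * N)
    (hbase1 : ∀ d : ℕ, T 1 d ≤ c)
    (hrec : ∀ N d : ℕ, 2 ≤ N → 1 ≤ d →
      T N d ≤ 2 * T ((N + 1) / 2) d + T N (d - 1) + c * N) :
    ∀ N d : ℕ, 1 ≤ N →
      T N d ≤ (Nat.choose (d + Nat.clog 2 N + 2) (d + 1) : ℝ) * c * N := by
  intro N d hN
  rcases hN.eq_or_lt with rfl | hN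
  · have hpos : (1 : ℝ) ≤ Nat.choose (d + Nat.clog 2 1 + 2) (d + 1) := by
      exact_mod_cast Nat.choose_pos (by omega)
    have := mul_le_mul_of_nonneg_right hpos hc.le
    have := hbase1 d
    push_cast
    linarith
  · obtain ⟨k, hk⟩ : ∃ k, Nat.clog 2 N = k + 1 :=
      Nat.exists_eq_succ_of_ne_zero (Nat.clog_pos one_lt_two hN).ne'
    have hle : N ≤ 2 ^ (k + 1) := hk ▸ Nat.le_pow_clog one_lt_two N
    have hlt : 2 ^ k < N := (Nat.lt_clog_iff_pow_lt one_lt_two).mp (by omega)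
    rw [hk, mul_comm _ c, mul_assoc]
    refine (recurrence_le_pascalCorrection hc hbase0 hbase1 hrec k N d hlt hle).trans
      (mul_le_mul_of_nonneg_left ?_ hc.le)
    have hz := neg_two_pow_mul_pascalCorrection_le k d
    have hN' : (1 : ℝ) ≤ N := by exact_mod_cast hN.le
    linarith
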